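/- For every proper filter F in S, the set d(F) ∩ E is an E-filter; moreover, if U is an ultrafilter in S, then d(U) ∩ E is an E-ultrafilter. -/

import Mathlib

/-- An inverse semigroup with zero: every element `a` has a unique `a⁻¹` with
`a * a⁻¹ * a = a` and `a⁻¹ * a * a⁻¹ = a⁻¹`, and `0` is absorbing. -/
class InvSemigroupWithZero (S : Type*) extends Semigroup S, Zero S, Inv S where
  mul_inv_mul : ∀ a : S, a * a⁻¹ * a = a
  inv_mul_inv : ∀ a : S, a⁻¹ * a * a⁻¹ = a⁻¹
  inv_unique : ∀ a b : S, a * b * a = a → b * a * b = b → b = a⁻¹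
  zero_mul : ∀ a : S, 0 * a = 0
  mul_zero : ∀ a : S, a * 0 = 0

namespace InvSemigroupWithZero

variable {S : Type*} [InvSemigroupWithZero S]

/-- The natural partial order on `S`: `a ≤ b` iff `a = a * a⁻¹ * b`. -/
def sle (a b : S) : Prop := a = a * a⁻¹ * b

/-- `↓s`, the down-set of `s` w.r.t. the natural partial order. -/
def dwn (s : S) : Set S := {t : S | sle t s}

/-- `↑A`, the up-set generated by `A` w.r.t. the natural partial order. -/
def up (A : Set S) : Set S := {b : S | ∃ a ∈ A, sle a b}

/-- A filter in `S`: a nonempty down-directed up-set. -/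
def IsFilt (F : Set S) : Prop :=
  F.Nonempty ∧ up F = F ∧ ∀ a ∈ F, ∀ b ∈ F, ∃ c ∈ F, sle c a ∧ sle c b

/-- A proper filter: a filter not containing `0`. -/
def IsPFilt (F : Set S) : Prop := IsFilt F ∧ (0 : S) ∉ F

/-- An ultrafilter: a proper filter maximal among proper filters. -/
def IsUltra (U : Set S) : Prop :=
  IsPFilt U ∧ ∀ G : Set S, IsPFilt G → U ⊆ G → U = G

/-- The set `E` of idempotents of `S`. -/
def E (S : Type*) [InvSemigroupWithZero S] : Set S := {e : S | e * e = e}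

/-- `F⁻¹ = {a⁻¹ : a ∈ F}`. -/
def finv (F : Set S) : Set S := (fun a : S => a⁻¹) '' F

/-- `F · G = ↑{fg : f ∈ F, g ∈ G}`. -/
def fmul (F G : Set S) : Set S := up (Set.image2 (· * ·) F G)

/-- The source `d(F) := F⁻¹ · F`. -/
def src (F : Set S) : Set S := fmul (finv F) F

/-- The range `r(F) := F · F⁻¹`. -/
def rng (F : Set S) : Set S := fmul F (finv F)

/-- The natural partial order on the idempotents: `e ≤ f` iff `e = e * f`. -/
def ele (e f : S) : Prop := e = e * f

/-- The down-set of an idempotent `e` inside `E`. -/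
def edwn (e : S) : Set S := {f : S | f ∈ E S ∧ ele f e}

/-- The up-set generated by `A` inside `E`. -/
def eup (A : Set S) : Set S := {f : S | f ∈ E S ∧ ∃ a ∈ A, ele a f}

/-- An `E`-filter: a proper filter of the inverse semigroup `E` of idempotents. -/
def IsEFilt (ξ : Set S) : Prop :=
  ξ ⊆ E S ∧ ξ.Nonempty ∧ eup ξ = ξ ∧
    (∀ a ∈ ξ, ∀ b ∈ ξ, ∃ c ∈ ξ, ele c a ∧ ele c b) ∧ (0 : S) ∉ ξ

/-- An `E`-ultrafilter: an `E`-filter maximal among `E`-filters. -/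
def IsEUltra (ξ : Set S) : Prop :=
  IsEFilt ξ ∧ ∀ η : Set S, IsEFilt η → ξ ⊆ η → ξ = η

/-- `β_s(ξ) = {f ∈ E : s·e·s⁻¹ ≤ f for some e ∈ ξ}`. -/
def beta (s : S) (ξ : Set S) : Set S :=
  {f : S | f ∈ E S ∧ ∃ e ∈ ξ, sle (s * e * s⁻¹) f}

/-- The set of proper filters in `S`. -/
abbrev PFilt (S : Type*) [InvSemigroupWithZero S] := {F : Set S // IsPFilt F}

/-- The patch topology on the set of proper filters, generated by the sets
`F(s;T) = {F : s ∈ F, F ∩ T = ∅}` for `s ∈ S` and finite `T ⊆ ↓s`. -/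
instance patchTopology : TopologicalSpace (PFilt S) :=
  TopologicalSpace.generateFrom
    {O : Set (PFilt S) | ∃ (s : S) (T : Set S), T.Finite ∧ T ⊆ dwn s ∧
      O = {F : PFilt S | s ∈ F.1 ∧ F.1 ∩ T = ∅}}

/-- The set of idempotent proper filters in `S`. -/
abbrev IPFilt (S : Type*) [InvSemigroupWithZero S] :=
  {F : Set S // IsPFilt F ∧ (F ∩ E S).Nonempty}

/-- The subspace topology induced by the patch topology on proper filters. -/
instance : TopologicalSpace (IPFilt S) :=
  TopologicalSpace.induced (fun F => (⟨F.1, F.2.1⟩ : PFilt S)) inferInstance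

/-- The set of `E`-filters. -/
abbrev EFilt (S : Type*) [InvSemigroupWithZero S] := {ξ : Set S // IsEFilt ξ}

/-- The patch topology on the set of `E`-filters, generated by the sets
`P(e;X) = {ξ : e ∈ ξ, ξ ∩ X = ∅}` for `e ∈ E` and finite `X ⊆ ↓e ∩ E`. -/
instance : TopologicalSpace (EFilt S) :=
  TopologicalSpace.generateFrom
    {O : Set (EFilt S) | ∃ (e : S) (X : Set S), e ∈ E S ∧ X.Finite ∧ X ⊆ edwn e ∧
      O = {ξ : EFilt S | e ∈ ξ.1 ∧ ξ.1 ∩ X = ∅}}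

/-- The set of ultrafilters in `S`. -/
abbrev UFilt (S : Type*) [InvSemigroupWithZero S] := {U : Set S // IsUltra U}

/-- The subspace topology induced by the patch topology on proper filters. -/
instance : TopologicalSpace (UFilt S) :=
  TopologicalSpace.induced (fun U => (⟨U.1, U.2.1⟩ : PFilt S)) inferInstance

end InvSemigroupWithZero

open InvSemigroupWithZero

namespace InvSemigroupWithZero

variable {S : Type*} [InvSemigroupWithZero S]

theorem inv_eq_self_of_idem {e : S} (he : e * e = e) : e⁻¹ = e :=
  (inv_unique e e (by rw [he, he]) (by rw [he, he])).symm

theorem inv_inv' (a : S) : a⁻¹⁻¹ = a :=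
  (inv_unique a⁻¹ a (inv_mul_inv a) (mul_inv_mul a)).symm

theorem idem_mul_idem {e f : S} (he : e * e = e) (hf : f * f = f) :
    e * f * (e * f) = e * f := by
  obtain ⟨x, hx⟩ : ∃ x : S, x = (e * f)⁻¹ := ⟨_, rfl⟩
  have h1 : e * f * x * (e * f) = e * f := by rw [hx]; exact mul_inv_mul _
  have h2 : x * (e * f) * x = x := by rw [hx]; exact inv_mul_inv _
  have h3 : f * x * e = x := by
    rw [hx]
    refine inv_unique _ _ ?_ ?_ <;> rw [← hx]
    · calc e * f * (f * x * e) * (e * f) = e * (f * f) * x * (e * e) * f := by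
            simp only [mul_assoc]
        _ = e * f * x * (e * f) := by rw [he, hf]; simp only [mul_assoc]
        _ = e * f := h1
    · calc f * x * e * (e * f) * (f * x * e) = f * x * (e * e) * (f * f) * x * e := by
            simp only [mul_assoc]
        _ = f * (x * (e * f) * x) * e := by rw [he, hf]; simp only [mul_assoc]
        _ = f * x * e := by rw [h2]
  have h4 : x * x = x := by
    calc x * x = f * x * e * (f * x * e) := by rw [h3]
      _ = f * (x * (e * f) * x) * e := by simp only [mul_assoc]
      _ = x := by rw [h2, h3]
  have h5 : e * f = x := by
    rw [← inv_inv' (e * f), ← hx]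
    exact inv_eq_self_of_idem h4
  rw [h5, h4]

theorem idem_comm {e f : S} (he : e * e = e) (hf : f * f = f) : e * f = f * e := by
  have swap : ∀ {a b : S}, a * a = a → b * b = b → a * b * (b * a) * (a * b) = a * b := by
    intro a b ha hb
    calc a * b * (b * a) * (a * b) = a * (b * b) * (a * a) * b := by simp only [mul_assoc]
      _ = a * b * (a * b) := by rw [ha, hb]; simp only [mul_assoc]
      _ = a * b := idem_mul_idem ha hb
  have h := inv_unique (e * f) (f * e) (swap he hf) (swap hf he)
  rw [h, inv_eq_self_of_idem (idem_mul_idem he hf)]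

theorem inv_mul_idem (a : S) : a⁻¹ * a * (a⁻¹ * a) = a⁻¹ * a := by
  rw [← mul_assoc, inv_mul_inv]

theorem mul_inv_idem (a : S) : a * a⁻¹ * (a * a⁻¹) = a * a⁻¹ := by
  rw [← mul_assoc, mul_inv_mul]

theorem mul_inv_rev' (a b : S) : (a * b)⁻¹ = b⁻¹ * a⁻¹ := by
  have h := idem_comm (mul_inv_idem b) (inv_mul_idem a)
  refine (inv_unique _ _ ?_ ?_).symm
  · calc a * b * (b⁻¹ * a⁻¹) * (a * b) = a * (b * b⁻¹ * (a⁻¹ * a)) * b := by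
          simp only [mul_assoc]
      _ = a * a⁻¹ * a * (b * b⁻¹ * b) := by rw [h]; simp only [mul_assoc]
      _ = a * b := by rw [mul_inv_mul, mul_inv_mul]
  · calc b⁻¹ * a⁻¹ * (a * b) * (b⁻¹ * a⁻¹) = b⁻¹ * (a⁻¹ * a * (b * b⁻¹)) * a⁻¹ := by
          simp only [mul_assoc]
      _ = b⁻¹ * b * b⁻¹ * (a⁻¹ * a * a⁻¹) := by rw [← h]; simp only [mul_assoc]
      _ = b⁻¹ * a⁻¹ := by rw [inv_mul_inv, inv_mul_inv]

theorem sle_mul_idem (b : S) {e : S} (he : e * e = e) : sle (b * e) b := by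
  unfold sle
  rw [mul_inv_rev', inv_eq_self_of_idem he]
  calc b * e = b * b⁻¹ * b * e := by rw [mul_inv_mul]
    _ = b * (b⁻¹ * b * e) := by simp only [mul_assoc]
    _ = b * (e * e * (b⁻¹ * b)) := by rw [he, idem_comm (inv_mul_idem b) he]
    _ = b * e * (e * b⁻¹) * b := by simp only [mul_assoc]

theorem sle.eq_mul_inv_mul {a b : S} (h : sle a b) : a = b * (a⁻¹ * a) := by
  have hinv : a⁻¹ = b⁻¹ * (a * a⁻¹) := by
    conv_lhs => rw [h]
    rw [mul_inv_rev', inv_eq_self_of_idem (mul_inv_idem a)]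
  symm
  calc b * (a⁻¹ * a) = b * (b⁻¹ * (a * a⁻¹) * a) := by rw [← hinv]
    _ = b * b⁻¹ * (a * a⁻¹ * a) := by simp only [mul_assoc]
    _ = b * b⁻¹ * (a * a⁻¹ * b) := by rw [mul_inv_mul, ← h]
    _ = b * b⁻¹ * (a * a⁻¹) * b := by simp only [mul_assoc]
    _ = a * a⁻¹ * (b * b⁻¹) * b := by rw [idem_comm (mul_inv_idem b) (mul_inv_idem a)]
    _ = a * a⁻¹ * (b * b⁻¹ * b) := by simp only [mul_assoc]
    _ = a := by rw [mul_inv_mul, ← h]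

theorem sle.trans {a b c : S} (hab : sle a b) (hbc : sle b c) : sle a c := by
  have h : a = c * (b⁻¹ * b * (a⁻¹ * a)) := by
    rw [← mul_assoc, ← hbc.eq_mul_inv_mul]; exact hab.eq_mul_inv_mul
  rw [h]
  exact sle_mul_idem c (idem_mul_idem (inv_mul_idem b) (inv_mul_idem a))

theorem sle_refl (a : S) : sle a a := (mul_inv_mul a).symm

/-- If `a ≤ b` then `a⁻¹a ≤ b⁻¹b`. -/
theorem sle.ele_inv_mul {a b : S} (h : sle a b) : ele (a⁻¹ * a) (b⁻¹ * b) := by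
  have h1 : a * (b⁻¹ * b) = a := by
    calc a * (b⁻¹ * b) = a * a⁻¹ * b * (b⁻¹ * b) := by rw [← h]
      _ = a * a⁻¹ * (b * b⁻¹ * b) := by simp only [mul_assoc]
      _ = a := by rw [mul_inv_mul, ← h]
  unfold ele
  rw [mul_assoc, h1]

theorem ele.trans {a b c : S} (hab : ele a b) (hbc : ele b c) : ele a c := by
  unfold ele at *
  rw [hab, mul_assoc, ← hbc]

theorem mem_src_inter_E {F : Set S} (hF : IsFilt F) {e : S} :
    e ∈ src F ∩ E S ↔ e * e = e ∧ ∃ s ∈ F, ele (s⁻¹ * s) e := by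
  constructor
  · rintro ⟨⟨_, ⟨_, ⟨a, ha, rfl⟩, b, hb, rfl⟩, hle⟩, he : e * e = e⟩
    obtain ⟨c, hc, hca, hcb⟩ := hF.2.2 a ha b hb
    refine ⟨he, c, hc, ?_⟩
    obtain ⟨k, hk⟩ : ∃ k : S, a⁻¹ * b = k * e := ⟨_, hle⟩
    have hinv : c⁻¹ = a⁻¹ * (c * c⁻¹) := by
      conv_lhs => rw [hca]
      rw [mul_inv_rev', inv_eq_self_of_idem (mul_inv_idem c)]
    have h1 : c⁻¹ * c = k * e * (c⁻¹ * c) := by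
      calc c⁻¹ * c = a⁻¹ * (c * c⁻¹) * c := by rw [← hinv]
        _ = a⁻¹ * c := by rw [mul_assoc, mul_inv_mul]
        _ = a⁻¹ * (b * (c⁻¹ * c)) := by rw [← hcb.eq_mul_inv_mul]
        _ = k * e * (c⁻¹ * c) := by rw [← hk, mul_assoc]
    calc c⁻¹ * c = k * (e * e) * (c⁻¹ * c) := by rw [he, ← h1]
      _ = k * e * (e * (c⁻¹ * c)) := by simp only [mul_assoc]
      _ = k * e * (c⁻¹ * c) * e := by
        rw [idem_comm he (inv_mul_idem c)]; simp only [mul_assoc]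
      _ = c⁻¹ * c * e := by rw [← h1]
  · rintro ⟨he, s, hs, hse⟩
    refine ⟨⟨_, ⟨s⁻¹, ⟨s, hs, rfl⟩, s, hs, rfl⟩, ?_⟩, he⟩
    change s⁻¹ * s = s⁻¹ * s * (s⁻¹ * s)⁻¹ * e
    rw [inv_eq_self_of_idem (inv_mul_idem s), inv_mul_idem]
    exact hse

theorem IsPFilt.isEFilt_src_inter_E {F : Set S} (hF : IsPFilt F) : IsEFilt (src F ∩ E S) := by
  refine ⟨Set.inter_subset_right, ?_, ?_, ?_, ?_⟩
  · obtain ⟨s, hs⟩ := hF.1.1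
    exact ⟨s⁻¹ * s, (mem_src_inter_E hF.1).2
      ⟨inv_mul_idem s, s, hs, (inv_mul_idem s).symm⟩⟩
  · ext f
    constructor
    · rintro ⟨hf, e, he, hef⟩
      obtain ⟨-, s, hs, hse⟩ := (mem_src_inter_E hF.1).1 he
      exact (mem_src_inter_E hF.1).2 ⟨hf, s, hs, hse.trans hef⟩
    · intro hf
      exact ⟨hf.2, f, hf, hf.2.symm⟩
  · intro e he f hf
    obtain ⟨-, s, hs, hse⟩ := (mem_src_inter_E hF.1).1 he
    obtain ⟨-, t, ht, htf⟩ := (mem_src_inter_E hF.1).1 hf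
    obtain ⟨u, hu, hus, hut⟩ := hF.1.2.2 s hs t ht
    exact ⟨u⁻¹ * u, (mem_src_inter_E hF.1).2
      ⟨inv_mul_idem u, u, hu, (inv_mul_idem u).symm⟩,
      hus.ele_inv_mul.trans hse, hut.ele_inv_mul.trans htf⟩
  · intro h0
    obtain ⟨-, s, hs, hse⟩ := (mem_src_inter_E hF.1).1 h0
    have : s = 0 := by
      rw [← mul_inv_mul s, mul_assoc, hse, mul_zero, mul_zero]
    exact hF.2 (this ▸ hs)

theorem IsEFilt.mul_mem {ξ : Set S} (hξ : IsEFilt ξ) {e f : S} (he : e ∈ ξ) (hf : f ∈ ξ) :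
    e * f ∈ ξ := by
  obtain ⟨c, hc, hce, hcf⟩ := hξ.2.2.2.1 e he f hf
  rw [← hξ.2.2.1]
  refine ⟨idem_mul_idem (hξ.1 he) (hξ.1 hf), c, hc, ?_⟩
  unfold ele at *
  rw [← mul_assoc, ← hce, ← hcf]

/-- The filter generated by the products `s * e` with `s ∈ F` and `e ∈ η` is proper
when `η` contains the idempotents of the source of `F`. -/
theorem IsPFilt.isPFilt_fmul {F η : Set S} (hF : IsPFilt F) (hη : IsEFilt η)
    (hsub : src F ∩ E S ⊆ η) : IsPFilt (fmul F η) := by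
  refine ⟨⟨?_, ?_, ?_⟩, ?_⟩
  · obtain ⟨s, hs⟩ := hF.1.1
    obtain ⟨e, he⟩ := hη.2.1
    exact ⟨s * e, s * e, ⟨s, hs, e, he, rfl⟩, sle_refl _⟩
  · ext b
    constructor
    · rintro ⟨a, ⟨x, hx, hxa⟩, hab⟩
      exact ⟨x, hx, hxa.trans hab⟩
    · intro hb
      exact ⟨b, hb, sle_refl b⟩
  · rintro a ⟨_, ⟨s, hs, e, he, rfl⟩, hsa⟩ b ⟨_, ⟨t, ht, f, hf, rfl⟩, htb⟩
    obtain ⟨u, hu, hus, hut⟩ := hF.1.2.2 s hs t ht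
    have hE : ∀ {x}, x ∈ η → x * x = x := fun hx => hη.1 hx
    have key : ∀ {v x y : S}, sle u v → x * x = x → y * y = y →
        sle (u * (x * y)) (v * x) := by
      intro v x y huv hx hy
      have : u * (x * y) = v * x * (u⁻¹ * u * y) := by
        calc u * (x * y) = v * (u⁻¹ * u) * (x * y) := by rw [← huv.eq_mul_inv_mul]
          _ = v * (u⁻¹ * u * x) * y := by simp only [mul_assoc]
          _ = v * x * (u⁻¹ * u * y) := by
            rw [idem_comm (inv_mul_idem u) hx]; simp only [mul_assoc]
      rw [this]
      exact sle_mul_idem _ (idem_mul_idem (inv_mul_idem u) hy)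
    refine ⟨u * (e * f), ⟨_, ⟨u, hu, e * f, hη.mul_mem he hf, rfl⟩, sle_refl _⟩,
      (key hus (hE he) (hE hf)).trans hsa, ?_⟩
    rw [idem_comm (hE he) (hE hf)]
    exact (key hut (hE hf) (hE he)).trans htb
  · rintro ⟨_, ⟨s, hs, e, he, rfl⟩, h⟩
    have h0 : s * e = 0 := by
      have h' : s * e = s * e * (s * e)⁻¹ * 0 := h
      rw [h', mul_zero]
    have hmem : s⁻¹ * s ∈ η := hsub ((mem_src_inter_E hF.1).2
      ⟨inv_mul_idem s, s, hs, (inv_mul_idem s).symm⟩)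
    have := hη.mul_mem hmem he
    rw [mul_assoc, h0, mul_zero] at this
    exact hη.2.2.2.2 this

theorem IsUltra.isEUltra_src_inter_E {U : Set S} (hU : IsUltra U) : IsEUltra (src U ∩ E S) := by
  refine ⟨hU.1.isEFilt_src_inter_E, fun η hη hsub => hsub.antisymm fun e he => ?_⟩
  have hUG : U = fmul U η := by
    refine hU.2 _ (hU.1.isPFilt_fmul hη hsub) fun s hs => ?_
    refine ⟨s * (s⁻¹ * s), ⟨s, hs, _, hsub ((mem_src_inter_E hU.1.1).2
      ⟨inv_mul_idem s, s, hs, (inv_mul_idem s).symm⟩), rfl⟩, ?_⟩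
    exact sle_mul_idem s (inv_mul_idem s)
  obtain ⟨s, hs⟩ := hU.1.1.1
  have hse : s * e ∈ U := by
    rw [hUG]
    exact ⟨_, ⟨s, hs, e, he, rfl⟩, sle_refl _⟩
  have hee : e * e = e := hη.1 he
  refine (mem_src_inter_E hU.1.1).2 ⟨hee, s * e, hse, ?_⟩
  unfold ele
  simp only [mul_assoc, hee]

end InvSemigroupWithZero

/-- For every proper filter `F`, the set `d(F) ∩ E` is an `E`-filter; and
for every ultrafilter `U`, the set `d(U) ∩ E` is an `E`-ultrafilter. -/
theorem stmt_11 {S : Type*} [InvSemigroupWithZero S] :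
    (∀ F : Set S, IsPFilt F → IsEFilt (src F ∩ E S)) ∧
    (∀ U : Set S, IsUltra U → IsEUltra (src U ∩ E S)) := by
  exact ⟨fun _ hF => hF.isEFilt_src_inter_E, fun _ hU => hU.isEUltra_src_inter_E⟩
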